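/- Suppose G : ℝ → Matrix (Fin m) (Fin m) ℝ is a symmetric matrix polynomial in one variable with G(x) positive semidefinite for all x ∈ ℝ. Then G is a sum of squares of matrix polynomials: G(x) = Σᵢ Gᵢ(x)ᵀ Gᵢ(x) for finitely many matrix polynomials Gᵢ. -/

import Mathlib

open Matrix Polynomial

lemma exists_proj {ι : Type} [Fintype ι] {n : Type} [Fintype n] (A B : Matrix ι n ℂ)
    (h : Bᴴ * A = 0) : ∃ P : ι → ι → ℂ, (∀ i j, star (P i j) = P j i) ∧
      (∀ i j, ∑ k, P i k * P k j = P i j) ∧ (∀ i j, ∑ k, P i k * A k j = 0) ∧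
      (∀ i j, ∑ k, P i k * B k j = B i j) := by
  classical
  let b : n → EuclideanSpace ℂ ι := fun j => WithLp.toLp 2 (fun i => B i j)
  let K : Submodule ℂ (EuclideanSpace ℂ ι) := Submodule.span ℂ (Set.range b)
  let T := K.starProjection
  let P : Matrix ι ι ℂ := (Matrix.toEuclideanCLM (n := ι) (𝕜 := ℂ)).symm T
  have hT : Matrix.toEuclideanCLM (n := ι) (𝕜 := ℂ) P = T := by simp [P]
  have hproj : IsStarProjection T := isStarProjection_starProjection
  have hP : Pᴴ = P := by
    have : star P = P := by
      apply EquivLike.injective (Matrix.toEuclideanCLM (n := ι) (𝕜 := ℂ))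
      rw [map_star, hT]; exact hproj.isSelfAdjoint
    exact this
  have hP2 : P * P = P := by
    apply EquivLike.injective (Matrix.toEuclideanCLM (n := ι) (𝕜 := ℂ))
    rw [map_mul, hT]; exact hproj.isIdempotentElem
  have key : ∀ v : ι → ℂ, P *ᵥ v = WithLp.ofLp (T (WithLp.toLp 2 v)) := by
    intro v
    rw [← hT, Matrix.toEuclideanCLM_toLp]
  refine ⟨P, fun i j => ?_, fun i j => ?_, fun i j => ?_, fun i j => ?_⟩
  · rw [← Matrix.conjTranspose_apply, hP]
  · rw [← Matrix.mul_apply, hP2]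
  · have := congrFun (key (fun k => A k j)) i
    have h0 : T (WithLp.toLp 2 (fun k => A k j)) = 0 := by
      rw [Submodule.starProjection_apply_eq_zero_iff, Submodule.mem_orthogonal]
      intro u hu
      induction hu using Submodule.span_induction with
      | mem x hx =>
        obtain ⟨l, rfl⟩ := hx
        have := congrFun (congrFun h l) j
        simp only [Matrix.mul_apply, Matrix.conjTranspose_apply, Matrix.zero_apply] at this
        simp only [b, PiLp.inner_apply, RCLike.inner_apply]
        rw [← this]
        exact Finset.sum_congr rfl fun _ _ => by simp [mul_comm]
      | zero => simp
      | add x y _ _ hx hy => rw [inner_add_left, hx, hy, add_zero]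
      | smul a x _ hx => rw [inner_smul_left, hx, mul_zero]
    rw [h0] at this
    simpa [Matrix.mulVec, dotProduct] using this
  · have := congrFun (key (fun k => B k j)) i
    have h0 : T (WithLp.toLp 2 (fun k => B k j)) = WithLp.toLp 2 (fun k => B k j) := by
      rw [Submodule.starProjection_eq_self_iff]
      exact Submodule.subset_span ⟨j, rfl⟩
    rw [h0] at this
    simpa [Matrix.mulVec, dotProduct] using this

noncomputable abbrev cj : ℂ[X] →+* ℂ[X] := Polynomial.mapRingHom (starRingEnd ℂ)

def QQ {n : Type} (G : n → n → ℂ[X]) : Prop :=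
  ∃ (ι : Type) (_ : Fintype ι) (H : ι → n → ℂ[X]), ∀ i j, G i j = ∑ k, cj (H k i) * H k j

lemma eval_cj (p : ℂ[X]) (z : ℂ) : (cj p).eval z = star (p.eval (star z)) := by
  induction p using Polynomial.induction_on' with
  | add p q hp hq => simp only [map_add, eval_add, hp, hq, star_add]
  | monomial n a => simp [Polynomial.map_monomial]

lemma QQ_step {n : Type} [Fintype n] (G : n → n → ℂ[X]) (z : ℂ)
    (h : QQ fun i j => (X - C z) * (X - C (star z)) * G i j) : QQ G := by
  classical
  obtain ⟨ι, _, H, hH⟩ := h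
  obtain ⟨P, hP1, hP2, hPA, hPB⟩ := exists_proj (Matrix.of fun k j => (H k j).eval z)
    (Matrix.of fun k j => (H k j).eval (star z)) (by
      ext i j
      have := congrArg (eval z) (hH i j)
      simp only [eval_mul, eval_sub, eval_X, eval_C, sub_self, zero_mul, eval_finsetSum,
        eval_cj] at this
      simp only [Matrix.mul_apply, Matrix.conjTranspose_apply, Matrix.of_apply, Matrix.zero_apply]
      exact this.symm)
  simp only [Matrix.of_apply] at hPA hPB
  have h1 : ∀ k j, ∃ K : ℂ[X], ∑ l, C (P k l) * H l j = (X - C z) * K := by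
    intro k j
    refine dvd_iff_isRoot.2 ?_
    simp only [IsRoot.def, eval_finsetSum, eval_mul, eval_C, hPA]
  have h2 : ∀ k j, ∃ K : ℂ[X], H k j - ∑ l, C (P k l) * H l j = (X - C (star z)) * K := by
    intro k j
    refine dvd_iff_isRoot.2 ?_
    simp only [IsRoot.def, eval_finsetSum, eval_mul, eval_C, hPB, eval_sub, sub_self]
  choose K hK using h1
  choose L hL using h2
  refine ⟨ι ⊕ ι, inferInstance, Sum.elim K L, fun i j => ?_⟩
  have hne : (X - C z) * (X - C (star z)) ≠ (0 : ℂ[X]) :=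
    mul_ne_zero (X_sub_C_ne_zero _) (X_sub_C_ne_zero _)
  apply mul_left_cancel₀ hne
  refine (hH i j).trans ?_
  simp only [Fintype.sum_sum_type, Sum.elim_inl, Sum.elim_inr, mul_add, Finset.mul_sum]
  have e1 : ∀ k, (X - C z) * (X - C (star z)) * (cj (K k i) * K k j)
      = cj (∑ l, C (P k l) * H l i) * ∑ l, C (P k l) * H l j := by
    intro k
    rw [hK, hK]; simp; ring
  have e2 : ∀ k, (X - C z) * (X - C (star z)) * (cj (L k i) * L k j)
      = cj (H k i - ∑ l, C (P k l) * H l i) * (H k j - ∑ l, C (P k l) * H l j) := by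
    intro k
    rw [hL, hL]; simp; ring
  simp only [e1, e2]
  let p : Matrix ι ι ℂ[X] := Matrix.of fun a b => C (P a b)
  let u : ι → ℂ[X] := fun k => cj (H k i)
  let v : ι → ℂ[X] := fun k => H k j
  have hp2 : p * p = p := by
    ext1 a b
    simp only [p, Matrix.mul_apply, Matrix.of_apply, ← C_mul, ← map_sum, hP2]
  have f1 : ∀ k, cj (∑ l, C (P k l) * H l i) = (u ᵥ* p) k := by
    intro k
    simp only [map_sum, map_mul, Matrix.vecMul, dotProduct, u, p, Matrix.of_apply]
    refine Finset.sum_congr rfl fun l _ => ?_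
    rw [mul_comm, ← hP1 k l]; simp
  have f2 : ∀ k, (∑ l, C (P k l) * H l j) = (p *ᵥ v) k := fun k => rfl
  have g : (u ᵥ* p) ⬝ᵥ (p *ᵥ v) = (u ᵥ* p) ⬝ᵥ v := by
    rw [Matrix.dotProduct_mulVec, Matrix.vecMul_vecMul, hp2]
  have goal : u ⬝ᵥ v = (u ᵥ* p) ⬝ᵥ (p *ᵥ v) + (u - u ᵥ* p) ⬝ᵥ (v - p *ᵥ v) := by
    rw [sub_dotProduct, dotProduct_sub, dotProduct_sub, g, Matrix.dotProduct_mulVec u]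
    ring
  simp only [map_sub, f1, f2]
  exact goal

noncomputable abbrev cx (p : ℝ[X]) : ℂ[X] := p.map Complex.ofRealHom

lemma QQ_remove {n : Type} [Fintype n] (G : n → n → ℂ[X]) : ∀ (d : ℕ) (a : ℝ[X]),
    a.natDegree ≤ d → a ≠ 0 → (∀ x, 0 ≤ a.eval x) → QQ (fun i j => cx a * G i j) → QQ G := by
  intro d
  induction d with
  | zero =>
    intro a hd h0 hpos ⟨ι, _, H, hH⟩
    obtain ⟨c, rfl⟩ : ∃ c, a = C c := ⟨_, eq_C_of_natDegree_le_zero hd⟩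
    have hc : 0 < c := lt_of_le_of_ne (by simpa using hpos 0) (by rintro rfl; simp at h0)
    refine ⟨ι, inferInstance, fun k j => C (((Real.sqrt c)⁻¹ : ℝ) : ℂ) * H k j, fun i j => ?_⟩
    have h3 : (C (((Real.sqrt c)⁻¹ : ℝ) : ℂ)) * C (((Real.sqrt c)⁻¹ : ℝ) : ℂ) * C (c : ℂ) = 1 := by
      rw [← C_mul, ← C_mul, ← Complex.ofReal_mul, ← Complex.ofReal_mul, ← mul_inv,
        Real.mul_self_sqrt hc.le, inv_mul_cancel₀ hc.ne']
      simp
    have h4 := hH i j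
    simp only [cx, map_C, Complex.ofRealHom_eq_coe] at h4
    calc G i j = (C (((Real.sqrt c)⁻¹ : ℝ) : ℂ)) * C (((Real.sqrt c)⁻¹ : ℝ) : ℂ) *
          (C (c : ℂ) * G i j) := by rw [← mul_assoc, h3, one_mul]
      _ = _ := by
        rw [h4, Finset.mul_sum]
        refine Finset.sum_congr rfl fun k _ => ?_
        simp only [map_mul, coe_mapRingHom, map_C, Complex.conj_ofReal]
        ring
  | succ d ih =>
    intro a hd h0 hpos hQ
    by_cases hdeg : a.natDegree ≤ d
    · exact ih a hdeg h0 hpos hQ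
    have main : ∀ (z : ℂ) (p b : ℝ[X]), a = p * b → cx p = (X - C z) * (X - C (star z)) →
        1 ≤ p.natDegree → (∀ x, 0 ≤ b.eval x) → QQ G := by
      intro z p b hab hp hpd hb
      have hb0 : b ≠ 0 := by rintro rfl; simp at hab; exact h0 hab
      have hp0 : p ≠ 0 := by rintro rfl; simp at hab; exact h0 hab
      refine ih b ?_ hb0 hb ?_
      · rw [hab, natDegree_mul hp0 hb0] at hd; omega
      · apply QQ_step _ z
        convert hQ using 3
        rw [hab, ← hp, cx, cx, cx, Polynomial.map_mul, mul_assoc]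
    obtain ⟨z, hz⟩ := Complex.exists_root (f := cx a) (by
      rw [cx, degree_map]
      exact natDegree_pos_iff_degree_pos.1 (by omega))
    have hz' : aeval z a = 0 := by
      rw [IsRoot.def, cx, eval_map] at hz
      exact hz
    by_cases him : z.im = 0
    · obtain ⟨r, rfl⟩ : ∃ r : ℝ, z = r := ⟨z.re, Complex.ext rfl him⟩
      have hr : a.eval r = 0 := by
        have := hz'
        rw [← Complex.coe_algebraMap, aeval_algebraMap_apply] at this
        simpa using this
      obtain ⟨b, hb⟩ := dvd_iff_isRoot.2 hr
      have hder : a.derivative.eval r = 0 := by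
        refine IsLocalMin.hasDerivAt_eq_zero (f := fun x => a.eval x) (a := r) ?_ (a.hasDerivAt r)
        exact Filter.Eventually.of_forall fun x => by simp only [hr]; exact hpos x
      have hbr : b.eval r = 0 := by
        rw [hb] at hder
        simpa [derivative_mul] using hder
      obtain ⟨c, hc⟩ := dvd_iff_isRoot.2 hbr
      have hac : a = ((X - C r) * (X - C r)) * c := by rw [mul_assoc, ← hc, ← hb]
      refine main r ((X - C r) * (X - C r)) c hac ?_ ?_ ?_
      · simp [cx]
      · rw [natDegree_mul (X_sub_C_ne_zero _) (X_sub_C_ne_zero _)]; simp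
      · have hcl : IsClosed {x : ℝ | 0 ≤ c.eval x} :=
          isClosed_le continuous_const c.continuous
        have hsub : ({r}ᶜ : Set ℝ) ⊆ {x : ℝ | 0 ≤ c.eval x} := by
          intro x hx
          have h5 := hpos x
          rw [hac] at h5
          simp only [eval_mul, eval_sub, eval_X, eval_C] at h5
          have hx' : x - r ≠ 0 := sub_ne_zero.2 hx
          exact nonneg_of_mul_nonneg_right h5 (mul_self_pos.2 hx')
        intro x
        have := (dense_compl_singleton r).closure_eq ▸ closure_minimal hsub hcl
        exact this (Set.mem_univ x)
    · obtain ⟨b, hb⟩ := quadratic_dvd_of_aeval_eq_zero_im_ne_zero a hz' him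
      refine main z _ b hb ?_ ?_ ?_
      · have e1 : ((2 * z.re : ℝ) : ℂ) = z + star z := by
          rw [Complex.star_def, Complex.add_conj]; 
        have e2 : ((‖z‖ ^ 2 : ℝ) : ℂ) = z * star z := by
          rw [Complex.star_def, Complex.mul_conj, Complex.normSq_eq_norm_sq]
        simp only [cx, Polynomial.map_add, Polynomial.map_sub, Polynomial.map_mul,
          Polynomial.map_pow, map_X, map_C, Complex.ofRealHom_eq_coe, e1, e2]
        simp only [C_add, C_mul]; ring
      · have : (X ^ 2 - C (2 * z.re) * X + C (‖z‖ ^ 2) : ℝ[X]).natDegree = 2 := by compute_degree!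
        omega
      · intro x
        have h5 := hpos x
        rw [hb] at h5
        simp only [eval_mul, eval_sub, eval_X, eval_C, eval_add, eval_pow] at h5
        refine nonneg_of_mul_nonneg_right h5 ?_
        rw [← Complex.normSq_eq_norm_sq, Complex.normSq_apply]
        nlinarith [sq_nonneg (x - z.re), mul_self_pos.2 him]

lemma QQ_main : ∀ (m : ℕ) (G : Fin m → Fin m → ℝ[X]), (∀ i j, G i j = G j i) →
    (∀ (x : ℝ) (y : Fin m → ℝ), 0 ≤ ∑ i, ∑ j, y i * y j * (G i j).eval x) →
    QQ fun i j => cx (G i j) := by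
  intro m
  induction m with
  | zero => intro G _ _; exact ⟨Empty, inferInstance, fun _ _ => 0, fun i => i.elim0⟩
  | succ m ih =>
    intro G hs hG
    have disc : ∀ (x : ℝ) (y : Fin m → ℝ), (∑ j, y j * (G 0 j.succ).eval x) ^ 2 ≤
        (G 0 0).eval x * ∑ i, ∑ j, y i * y j * (G i.succ j.succ).eval x := by
      intro x y
      have := discrim_le_zero (a := (G 0 0).eval x) (b := 2 * ∑ j, y j * (G 0 j.succ).eval x)
        (c := ∑ i, ∑ j, y i * y j * (G i.succ j.succ).eval x) (by
          intro t
          have := hG x (Fin.cons t y)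
          simp only [Fin.sum_univ_succ, Fin.cons_zero, Fin.cons_succ, Finset.sum_add_distrib] at this
          have e1 : ∑ j, t * y j * (G 0 j.succ).eval x = t * ∑ j, y j * (G 0 j.succ).eval x := by
            rw [Finset.mul_sum]; exact Finset.sum_congr rfl fun _ _ => by ring
          have e2 : ∑ j, y j * t * (G j.succ 0).eval x = t * ∑ j, y j * (G 0 j.succ).eval x := by
            rw [Finset.mul_sum]; exact Finset.sum_congr rfl fun j _ => by rw [hs j.succ 0]; ring
          rw [e1, e2] at this
          linarith)
      rw [discrim] at this
      nlinarith
    have hpos : ∀ x, 0 ≤ (G 0 0).eval x := by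
      intro x
      have := hG x (Fin.cons 1 0)
      simpa [Fin.sum_univ_succ] using this
    by_cases h0 : G 0 0 = 0
    · have hz : ∀ j : Fin m, G 0 j.succ = 0 := by
        intro j
        refine Polynomial.funext fun x => ?_
        have := disc x (Pi.single j 1)
        simp only [h0, eval_zero, zero_mul, Pi.single_apply, ite_mul, one_mul,
          Finset.sum_ite_eq', Finset.mem_univ, if_true] at this
        simpa using pow_eq_zero_iff (two_ne_zero) |>.1 (le_antisymm this (sq_nonneg _))
      obtain ⟨ι, _, H, hH⟩ := ih (fun i j => G i.succ j.succ) (fun i j => hs _ _) (by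
        intro x y
        have := hG x (Fin.cons 0 y)
        simpa [Fin.sum_univ_succ] using this)
      refine ⟨ι, inferInstance, fun k => Fin.cons 0 (H k), fun i j => ?_⟩
      refine Fin.cases ?_ (fun i => ?_) i <;> refine Fin.cases ?_ (fun j => ?_) j
      · simp [h0]
      · simp [hz]
      · simp [hs i.succ 0, hz]
      · simpa using hH i j
    · refine QQ_remove _ _ (G 0 0) le_rfl h0 hpos ?_
      obtain ⟨ι, _, H, hH⟩ := ih (fun i j => G 0 0 * G i.succ j.succ - G 0 i.succ * G 0 j.succ)
        (fun i j => by rw [hs i.succ j.succ]; ring) (by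
        intro x y
        have := disc x y
        have e : ∑ i, ∑ j, y i * y j * (G 0 0 * G (Fin.succ i) (Fin.succ j)
            - G 0 (Fin.succ i) * G 0 (Fin.succ j)).eval x =
          (G 0 0).eval x * ∑ i, ∑ j, y i * y j * (G i.succ j.succ).eval x -
            (∑ j, y j * (G 0 j.succ).eval x) ^ 2 := by
          rw [sq, Finset.sum_mul_sum, Finset.mul_sum, ← Finset.sum_sub_distrib]
          refine Finset.sum_congr rfl fun i _ => ?_
          rw [Finset.mul_sum, ← Finset.sum_sub_distrib]
          refine Finset.sum_congr rfl fun j _ => ?_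
          simp only [eval_sub, eval_mul]; ring
        rw [e]; linarith)
      have hcj : ∀ p : ℝ[X], cj (cx p) = cx p := by
        intro p
        ext k; simp [cx]
      refine ⟨Unit ⊕ ι, inferInstance, Sum.elim (fun _ j => cx (G 0 j))
        (fun k => Fin.cons 0 (H k)), fun i j => ?_⟩
      simp only [Fintype.sum_sum_type, Sum.elim_inl, Sum.elim_inr, hcj, Finset.univ_unique,
        Finset.sum_singleton]
      refine Fin.cases ?_ (fun i => ?_) i <;> refine Fin.cases ?_ (fun j => ?_) j
      · simp
      · simp
      · simp [hs i.succ 0, mul_comm]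
      · simp only [Fin.cons_succ, ← hH i j]
        simp [cx]

lemma exists_re_im (p : ℂ[X]) : ∃ a b : ℝ[X], p = cx a + C Complex.I * cx b := by
  induction p using Polynomial.induction_on' with
  | add p q hp hq =>
    obtain ⟨a, b, rfl⟩ := hp
    obtain ⟨c, d, rfl⟩ := hq
    exact ⟨a + c, b + d, by simp only [cx, Polynomial.map_add]; ring⟩
  | monomial n z =>
    refine ⟨monomial n z.re, monomial n z.im, ?_⟩
    simp only [cx, map_monomial, C_mul_monomial, ← map_add, Complex.ofRealHom_eq_coe]
    rw [mul_comm, Complex.re_add_im]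

theorem stmt15_univariate_matrix_sos (m : ℕ)
    (G : Matrix (Fin m) (Fin m) (Polynomial ℝ))
    (hsym : Gᵀ = G)
    (hpsd : ∀ x : ℝ, (Matrix.of fun i j => Polynomial.eval x (G i j)).PosSemidef) :
    ∃ (r : ℕ) (H : Fin r → Matrix (Fin m) (Fin m) (Polynomial ℝ)),
      G = ∑ s : Fin r, (H s)ᵀ * H s := by
  have hs : ∀ i j, G i j = G j i := fun i j => congrFun (congrFun hsym j) i
  obtain ⟨ι, _, H, hH⟩ := QQ_main m G hs (by
    intro x y
    have := (hpsd x).dotProduct_mulVec_nonneg y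
    simp only [dotProduct, Matrix.mulVec, Matrix.of_apply, Pi.star_apply, star_trivial,
      Finset.mul_sum] at this
    refine this.trans_eq (Finset.sum_congr rfl fun i _ => Finset.sum_congr rfl fun j _ => ?_)
    ring)
  choose A B hAB using fun k j => exists_re_im (H k j)
  have hcj : ∀ p : ℝ[X], cj (cx p) = cx p := by
    intro p
    ext k; simp [cx]
  have hI : (C Complex.I * C Complex.I : ℂ[X]) = -1 := by rw [← C_mul]; simp
  have key : ∀ i j, G i j = ∑ k, (A k i * A k j + B k i * B k j) := by
    intro i j
    apply Polynomial.map_injective Complex.ofRealHom Complex.ofRealHom.injective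
    have h1 : cx (G i j) = _ := hH i j
    have h2 : cx (G j i) = _ := hH j i
    rw [hs j i] at h2
    have h3 : (2 : ℂ[X]) * cx (G i j) = 2 * cx (∑ k, (A k i * A k j + B k i * B k j)) := by
      rw [two_mul]
      nth_rewrite 1 [h1]
      rw [h2, ← Finset.sum_add_distrib, cx, Polynomial.map_sum, Finset.mul_sum]
      refine Finset.sum_congr rfl fun k _ => ?_
      rw [hAB k i, hAB k j]
      simp only [map_add, map_mul, hcj, Polynomial.map_add, Polynomial.map_mul]
      have : cj (C Complex.I) = - C Complex.I := by simp
      rw [this]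
      linear_combination (-2 * cx (B k i) * cx (B k j)) * hI
    exact mul_left_cancel₀ two_ne_zero h3
  cases m with
  | zero => exact ⟨0, fun _ => 0, by ext i; exact i.elim0⟩
  | succ m =>
    let R : ι ⊕ ι → Fin (m+1) → ℝ[X] := Sum.elim A B
    let e := Fintype.equivFin (ι ⊕ ι)
    refine ⟨_, fun s => Matrix.of fun i j => if i = 0 then R (e.symm s) j else 0, ?_⟩
    refine Matrix.ext fun i j => ?_
    rw [Matrix.sum_apply, e.symm.sum_comp (fun t => ((Matrix.of fun i j => if i = 0 then R t j else 0)ᵀ * (Matrix.of fun i j => if i = 0 then R t j else 0) : Matrix (Fin (m+1)) (Fin (m+1)) ℝ[X]) i j), key]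
    simp [Matrix.mul_apply, R, Finset.sum_add_distrib]
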